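/- arXiv:1711.08343 — 3 statements merged into one kernel-verified Lean document; each statement's English description precedes it below -/
import Mathlib

section
/- Let ν ≥ 0, let u, u′ : ℝ×ℝ³ → ℝ³, p, p′ : ℝ×ℝ³ → ℝ and f : ℝ×ℝ³ → ℝ³ be smooth and periodic in space, and let τ_M, τ_C : ℝ×ℝ³ → ℝ be smooth, periodic in space and strictly positive. Assume that for every time t: (i) the dynamic small-scale equations ∂ₜu′ + τ_M⁻¹u′ + r = 0 and p′ = −τ_C div u hold pointwise, where r := ∂ₜu + ((u+u′)·∇)u + ∇p − νΔu − f; (ii) the conservative VMSD large-scale equation tested with (w,q) = (u,p) holds, i.e. ∫_T [ u·∂ₜu + u·∂ₜu′ − ∇u:((u+u′)⊗(u+u′)) + 2ν ∇ˢu:∇u − ν Δu·u′ − ∇p·u′ − (div u) p′ ] dx = ∫_T u·f dx. Then the total kinetic energy E(t) := ½∫_T |u+u′|² dx satisfies, for every t, dE/dt = −2ν∫_T |∇ˢu|² dx + ∫_T u·f dx − ∫_T τ_M⁻¹|u′|² dx + ∫_T u′·f dx + 2ν∫_T Δu·u′ dx + ∫_T (div u) p′ dx + ∫_T ∇u:((u+u′)⊗(u+u′))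 dx − ∫_T u′·(((u+u′)·∇)u) dx. -/
open MeasureTheory Real

noncomputable section

/-- The periodicity cube `[0, 2π]³ ⊂ ℝ³`. -/
def Tcube : Set (Fin 3 → ℝ) := Set.Icc 0 (fun _ => 2 * Real.pi)

/-- Partial derivative of a scalar field on `ℝ³` in coordinate direction `j`. -/
def pd (f : (Fin 3 → ℝ) → ℝ) (j : Fin 3) (x : Fin 3 → ℝ) : ℝ :=
  fderiv ℝ f x (Pi.single j 1)

/-- `2π`-periodicity in each of the three coordinates. -/
def SpacePeriodic {α : Type*} (f : (Fin 3 → ℝ) → α) : Prop :=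
  ∀ (x : Fin 3 → ℝ) (j : Fin 3), f (x + Pi.single j (2 * Real.pi)) = f x

/-- Time derivative `∂ₜuᵢ` of the `i`-th component of a time-dependent vector field. -/
def dt (u : ℝ × (Fin 3 → ℝ) → (Fin 3 → ℝ)) (i : Fin 3) (t : ℝ) (x : Fin 3 → ℝ) : ℝ :=
  deriv (fun s => u (s, x) i) t

/-- Spatial partial derivative `∂ⱼuᵢ` of a time-dependent vector field. -/
def dx (u : ℝ × (Fin 3 → ℝ) → (Fin 3 → ℝ)) (i j : Fin 3) (t : ℝ) (x : Fin 3 → ℝ) : ℝ :=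
  pd (fun y => u (t, y) i) j x

/-- Spatial partial derivative `∂ⱼp` of a time-dependent scalar field. -/
def dxS (p : ℝ × (Fin 3 → ℝ) → ℝ) (j : Fin 3) (t : ℝ) (x : Fin 3 → ℝ) : ℝ :=
  pd (fun y => p (t, y)) j x

/-- Componentwise Laplacian `Δuᵢ` of a time-dependent vector field. -/
def lap (u : ℝ × (Fin 3 → ℝ) → (Fin 3 → ℝ)) (i : Fin 3) (t : ℝ) (x : Fin 3 → ℝ) : ℝ :=
  ∑ j, pd (fun y => dx u i j t y) j x

/-- Differentiation under the integral over a compact set, for jointly continuous derivatives. -/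
theorem hasDerivAt_setIntegral_of_continuous {X : Type*} [TopologicalSpace X] [MeasurableSpace X]
    [OpensMeasurableSpace X] [T2Space X] {μ : Measure X} [IsFiniteMeasureOnCompacts μ]
    {K : Set X} (hK : IsCompact K) {F F' : ℝ → X → ℝ} (hF : ∀ s, Continuous (F s))
    (hF' : Continuous fun q : ℝ × X => F' q.1 q.2)
    (h : ∀ s x, HasDerivAt (fun r => F r x) (F' s x) s) (t : ℝ) :
    HasDerivAt (fun s => ∫ x in K, F s x ∂μ) (∫ x in K, F' t x ∂μ) t := by
  obtain ⟨C, hC⟩ := ((isCompact_closedBall t 1).prod hK).exists_bound_of_continuousOn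
    hF'.continuousOn
  have hF'_slice : Continuous (F' t) := hF'.comp (Continuous.prodMk_right t)
  refine (hasDerivAt_integral_of_dominated_loc_of_deriv_le (s := Metric.closedBall t 1)
    (bound := fun _ => C) (Metric.closedBall_mem_nhds t one_pos) ?_ ?_ ?_ ?_ ?_ ?_).2
  · exact .of_forall fun s =>
      ((hF s).continuousOn.integrableOn_compact hK).aestronglyMeasurable
  · exact (hF t).continuousOn.integrableOn_compact hK
  · exact (hF'_slice.continuousOn.integrableOn_compact hK).aestronglyMeasurable
  · filter_upwards [ae_restrict_mem hK.measurableSet] with x hx s hs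
    exact hC (s, x) ⟨hs, hx⟩
  · exact integrableOn_const hK.measure_lt_top.ne
  · exact .of_forall fun x s _ => h s x

theorem contDiff_pd_slice {g : ℝ × (Fin 3 → ℝ) → ℝ} (hg : ContDiff ℝ (⊤ : ℕ∞) g) (j : Fin 3) :
    ContDiff ℝ (⊤ : ℕ∞) fun q : ℝ × (Fin 3 → ℝ) => pd (fun y => g (q.1, y)) j q.2 := by
  have h : (fun q : ℝ × (Fin 3 → ℝ) => pd (fun y => g (q.1, y)) j q.2)
      = fun q => fderiv ℝ g q (0, Pi.single j 1) := by
    ext ⟨t, x⟩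
    have hd : HasFDerivAt (fun y => g (t, y)) _ x :=
      ((hg.differentiable (by simp)).differentiableAt (x := (t, x))).hasFDerivAt.comp x
        (hasFDerivAt_prodMk_right t x)
    simp [pd, hd.fderiv]
  rw [h]
  exact (hg.fderiv_right (m := (⊤ : ℕ∞)) (by simp)).clm_apply contDiff_const

theorem contDiff_dx {u : ℝ × (Fin 3 → ℝ) → (Fin 3 → ℝ)} (hu : ContDiff ℝ (⊤ : ℕ∞) u)
    (i j : Fin 3) : ContDiff ℝ (⊤ : ℕ∞) fun q : ℝ × (Fin 3 → ℝ) => dx u i j q.1 q.2 :=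
  contDiff_pd_slice (contDiff_pi.1 hu i) j

theorem contDiff_lap {u : ℝ × (Fin 3 → ℝ) → (Fin 3 → ℝ)} (hu : ContDiff ℝ (⊤ : ℕ∞) u)
    (i : Fin 3) : ContDiff ℝ (⊤ : ℕ∞) fun q : ℝ × (Fin 3 → ℝ) => lap u i q.1 q.2 :=
  ContDiff.sum fun j _ => contDiff_pd_slice (contDiff_dx hu i j) j

theorem hasDerivAt_dt {u : ℝ × (Fin 3 → ℝ) → (Fin 3 → ℝ)} (hu : ContDiff ℝ (⊤ : ℕ∞) u)
    (i : Fin 3) (t : ℝ) (x : Fin 3 → ℝ) : HasDerivAt (fun s => u (s, x) i) (dt u i t x) t := by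
  have hc : ContDiff ℝ (⊤ : ℕ∞) fun s : ℝ => u (s, x) i :=
    (contDiff_pi.1 hu i).comp (contDiff_prodMk_left x)
  exact ((hc.differentiable (by simp)) t).hasDerivAt

theorem continuous_dt {u : ℝ × (Fin 3 → ℝ) → (Fin 3 → ℝ)} (hu : ContDiff ℝ (⊤ : ℕ∞) u)
    (i : Fin 3) : Continuous fun q : ℝ × (Fin 3 → ℝ) => dt u i q.1 q.2 := by
  have hg := contDiff_pi.1 hu i
  have h : (fun q : ℝ × (Fin 3 → ℝ) => dt u i q.1 q.2)
      = fun q => fderiv ℝ (fun q => u q i) q (1, 0) := by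
    ext ⟨t, x⟩
    exact (((hg.differentiable (by simp)).differentiableAt (x := (t, x))).hasFDerivAt.comp_hasDerivAt
      t ((hasDerivAt_id t).prodMk (hasDerivAt_const t x))).deriv
  rw [h]
  exact (hg.continuous_fderiv (by simp)).clm_apply continuous_const

/-- Energy evolution of the conservative residual-based VMS formulation with dynamic
small-scales (VMSD), formula (22) of the paper: besides the physical and small-scale
dissipation and the forcing terms, several terms without continuous counterpart appear. -/
theorem vmsd_energy_evolution
    (ν : ℝ) (hν : 0 ≤ ν)
    (u u' f : ℝ × (Fin 3 → ℝ) → (Fin 3 → ℝ))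
    (p p' τM τC : ℝ × (Fin 3 → ℝ) → ℝ)
    (hu : ContDiff ℝ (⊤ : ℕ∞) u) (hu' : ContDiff ℝ (⊤ : ℕ∞) u')
    (hf : ContDiff ℝ (⊤ : ℕ∞) f) (hp : ContDiff ℝ (⊤ : ℕ∞) p)
    (hp' : ContDiff ℝ (⊤ : ℕ∞) p')
    (hτM : ContDiff ℝ (⊤ : ℕ∞) τM) (hτC : ContDiff ℝ (⊤ : ℕ∞) τC)
    (hup : ∀ t, SpacePeriodic fun x => u (t, x))
    (hu'p : ∀ t, SpacePeriodic fun x => u' (t, x))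
    (hfp : ∀ t, SpacePeriodic fun x => f (t, x))
    (hpp : ∀ t, SpacePeriodic fun x => p (t, x))
    (hp'p : ∀ t, SpacePeriodic fun x => p' (t, x))
    (hτMp : ∀ t, SpacePeriodic fun x => τM (t, x))
    (hτCp : ∀ t, SpacePeriodic fun x => τC (t, x))
    (hτMpos : ∀ t x, 0 < τM (t, x)) (hτCpos : ∀ t x, 0 < τC (t, x))
    -- (i) dynamic small-scale equations ∂ₜu′ + τ_M⁻¹u′ + r = 0 and p′ = -τ_C div u
    (hsmall : ∀ t x i,
      dt u' i t x + (τM (t, x))⁻¹ * u' (t, x) i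
        + (dt u i t x + (∑ j, (u (t, x) j + u' (t, x) j) * dx u i j t x)
            + dxS p i t x - ν * lap u i t x - f (t, x) i) = 0)
    (hpsmall : ∀ t x, p' (t, x) = -(τC (t, x)) * (∑ i, dx u i i t x))
    -- (ii) the conservative VMSD large-scale equation tested with (w, q) = (u, p)
    (hlarge : ∀ t,
      (∫ x in Tcube,
        ((∑ i, u (t, x) i * dt u i t x)
          + (∑ i, u (t, x) i * dt u' i t x)
          - (∑ i, ∑ j, dx u i j t x
              * ((u (t, x) i + u' (t, x) i) * (u (t, x) j + u' (t, x) j)))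
          + 2 * ν * (∑ i, ∑ j, ((1/2) * (dx u i j t x + dx u j i t x)) * dx u i j t x)
          - ν * (∑ i, lap u i t x * u' (t, x) i)
          - (∑ i, dxS p i t x * u' (t, x) i)
          - (∑ i, dx u i i t x) * p' (t, x)))
      = ∫ x in Tcube, ∑ i, u (t, x) i * f (t, x) i) :
    ∀ t, HasDerivAt
      (fun s => (1/2) * ∫ x in Tcube, ∑ i, (u (s, x) i + u' (s, x) i)^2)
      (- (2 * ν * ∫ x in Tcube,
            ∑ i, ∑ j, ((1/2) * (dx u i j t x + dx u j i t x))^2)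
        + (∫ x in Tcube, ∑ i, u (t, x) i * f (t, x) i)
        - (∫ x in Tcube, (τM (t, x))⁻¹ * ∑ i, (u' (t, x) i)^2)
        + (∫ x in Tcube, ∑ i, u' (t, x) i * f (t, x) i)
        + 2 * ν * (∫ x in Tcube, ∑ i, lap u i t x * u' (t, x) i)
        + (∫ x in Tcube, (∑ i, dx u i i t x) * p' (t, x))
        + (∫ x in Tcube, ∑ i, ∑ j, dx u i j t x
            * ((u (t, x) i + u' (t, x) i) * (u (t, x) j + u' (t, x) j)))
        - (∫ x in Tcube, ∑ i, u' (t, x) i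
            * (∑ j, (u (t, x) j + u' (t, x) j) * dx u i j t x))) t := by
  intro t
  have cu (i) : Continuous fun q : ℝ × (Fin 3 → ℝ) => u (q.1, q.2) i :=
    (contDiff_pi.1 hu i).continuous
  have cu' (i) : Continuous fun q : ℝ × (Fin 3 → ℝ) => u' (q.1, q.2) i :=
    (contDiff_pi.1 hu' i).continuous
  have cdt (i) := continuous_dt hu i
  have cdt' (i) := continuous_dt hu' i
  have slice {g : ℝ × (Fin 3 → ℝ) → ℝ} (hg : Continuous g) : Continuous fun x => g (t, x) :=
    hg.comp (Continuous.prodMk_right t)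
  have hcu := hu.continuous
  have hcu' := hu'.continuous
  have hcf := hf.continuous
  have hcp' := hp'.continuous
  have hcτM := hτM.continuous
  have sdt (i) := slice (cdt i)
  have sdt' (i) := slice (cdt' i)
  have sdx (i j) := slice (contDiff_dx hu i j).continuous
  have slap (i) := slice (contDiff_lap hu i).continuous
  have sdp (j) : Continuous fun x => dxS p j t x := slice (contDiff_pd_slice hp j).continuous
  dsimp only at sdt sdt' sdx slap
  have hK : IsCompact Tcube := isCompact_Icc
  have int {g : (Fin 3 → ℝ) → ℝ} (hg : Continuous g) : IntegrableOn g Tcube :=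
    hg.continuousOn.integrableOn_compact hK
  have hE := (hasDerivAt_setIntegral_of_continuous (μ := volume) hK
    (F := fun s x => ∑ i, (u (s, x) i + u' (s, x) i) ^ 2)
    (F' := fun s x => ∑ i, 2 * (u (s, x) i + u' (s, x) i) * (dt u i s x + dt u' i s x))
    (fun s => continuous_finsetSum _ fun i _ =>
      (((cu i).add (cu' i)).pow 2).comp (Continuous.prodMk_right s))
    (continuous_finsetSum _ fun i _ =>
      (continuous_const.mul ((cu i).add (cu' i))).mul ((cdt i).add (cdt' i)))
    (fun s x => HasDerivAt.fun_sum fun i _ => by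
      simpa using ((hasDerivAt_dt hu i s x).add (hasDerivAt_dt hu' i s x)).fun_pow 2)
    t).const_mul (1 / 2)
  refine hE.congr_deriv (Eq.symm ?_)
  rw [← hlarge t]
  simp only [← integral_const_mul]
  rw [← integral_neg, ← integral_add, ← integral_sub, ← integral_add, ← integral_add,
    ← integral_add, ← integral_add, ← integral_sub]
  · refine integral_congr_ae (.of_forall fun x => ?_)
    simp only [Fin.sum_univ_three]
    have h0 := hsmall t x 0
    have h1 := hsmall t x 1
    have h2 := hsmall t x 2
    simp only [Fin.sum_univ_three] at h0 h1 h2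
    linear_combination -(u' (t, x) 0) * h0 - u' (t, x) 1 * h1 - u' (t, x) 2 * h2
  all_goals exact int (by fun_prop (disch := exact fun x => (hτMpos t x).ne'))
end
end

section
/- Let ν ≥ 0, let u, u′ : ℝ×ℝ³ → ℝ³, p, ζ : ℝ×ℝ³ → ℝ and f : ℝ×ℝ³ → ℝ³ be smooth and periodic in space, and let τ : ℝ×ℝ³ → ℝ be smooth, periodic in space and strictly positive. Assume that for every time t: (i) div u(t,·) = 0 pointwise; (ii) ∫_T ∇ζ·u′ dx = 0, ∫_T ∇p·u′ dx = 0 and ∫_T Δu·u′ dx = 0; (iii) ∂ₜu′ + τ⁻¹u′ + ∇ζ + r = 0 pointwise, where r := ∂ₜu + ((u+u′)·∇)u + ∇p − νΔu − f; (iv) the GLSDD large-scale equation tested with (w,q,θ) = (u,p,ζ) holds, i.e. ∫_T [ u·∂ₜu + u·∂ₜu′ − (((u+u′)·∇)u)·u′ + 2ν ∇ˢu:∇u + ν Δu·u′ + ∇ζ·u′ ] dx = ∫_T u·f dx. Then for every t, the large-scale energy E^h(t) := ½∫_T |u|² dx satisfies dE^h/dt = −ν∫_T |∇u|² dx + ∫_T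 u·f dx + ∫_T (((u+u′)·∇)u)·u′ dx − ∫_T u·∂ₜu′ dx, and the small-scale energy E′(t) := ½∫_T |u′|² dx satisfies dE′/dt = −∫_T τ⁻¹|u′|² dx + ∫_T u′·f dx − ∫_T (((u+u′)·∇)u)·u′ dx − ∫_T u′·∂ₜu dx. -/
open MeasureTheory Real

noncomputable section

section PartialDerivatives

variable {g h : (Fin 3 → ℝ) → ℝ}

lemma ContDiff.pd (hg : ContDiff ℝ (⊤ : ℕ∞) g) (j : Fin 3) : ContDiff ℝ (⊤ : ℕ∞) (pd g j) :=
  (hg.fderiv_right (m := (⊤ : ℕ∞)) (by simp)).clm_apply contDiff_const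

lemma ContDiff.differentiable_of_smooth {E F : Type*} [NormedAddCommGroup E] [NormedSpace ℝ E]
    [NormedAddCommGroup F] [NormedSpace ℝ F] {g : E → F} (hg : ContDiff ℝ (⊤ : ℕ∞) g) :
    Differentiable ℝ g :=
  hg.differentiable (by simp)

lemma pd_mul (hg : Differentiable ℝ g) (hh : Differentiable ℝ h) (j : Fin 3) (x : Fin 3 → ℝ) :
    pd (fun y => g y * h y) j x = pd g j x * h x + g x * pd h j x := by
  simp only [pd]
  rw [fderiv_fun_mul (hg x) (hh x)]
  simp
  ring

lemma pd_sum {F : Fin 3 → (Fin 3 → ℝ) → ℝ} (hF : ∀ i, Differentiable ℝ (F i)) (j : Fin 3)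
    (x : Fin 3 → ℝ) : pd (fun y => ∑ i, F i y) j x = ∑ i, pd (F i) j x := by
  simp only [pd]
  rw [fderiv_fun_sum fun i _ => hF i x]
  simp

lemma pd_pd_comm (hg : ContDiff ℝ (⊤ : ℕ∞) g) (i j : Fin 3) (x : Fin 3 → ℝ) :
    pd (pd g i) j x = pd (pd g j) i x := by
  have hd : Differentiable ℝ (fderiv ℝ g) :=
    (hg.fderiv_right (m := (⊤ : ℕ∞)) (by simp)).differentiable_of_smooth
  have key : ∀ k l : Fin 3,
      pd (pd g k) l x = fderiv ℝ (fderiv ℝ g) x (Pi.single l 1) (Pi.single k 1) := by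
    intro k l
    unfold pd
    rw [fderiv_clm_apply (hd x) (differentiableAt_const _)]
    simp
  rw [key, key]
  exact (hg.contDiffAt.isSymmSndFDerivAt (by simp; exact WithTop.coe_le_coe.2 le_top)).eq _ _

lemma SpacePeriodic.pd (hg : SpacePeriodic g) (j : Fin 3) : SpacePeriodic (pd g j) := by
  intro x k
  have : (fun y => g (y + Pi.single k (2 * Real.pi))) = g := funext fun y => hg y k
  unfold _root_.pd
  rw [← fderiv_comp_add_right, this]

end PartialDerivatives

lemma Continuous.integrableOn_Tcube {g : (Fin 3 → ℝ) → ℝ} (hg : Continuous g) :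
    IntegrableOn g Tcube :=
  hg.continuousOn.integrableOn_compact isCompact_Icc

lemma integrableOn_Tcube_sum_mul {a b : Fin 3 → (Fin 3 → ℝ) → ℝ} (ha : ∀ i, Continuous (a i))
    (hb : ∀ i, Continuous (b i)) : IntegrableOn (fun x => ∑ i, a i x * b i x) Tcube :=
  (continuous_finsetSum _ fun i _ => (ha i).mul (hb i)).integrableOn_Tcube

/-- The integral of a partial derivative of a smooth periodic function over the periodicity cube
vanishes. -/
lemma integral_pd_eq_zero {g : (Fin 3 → ℝ) → ℝ} (hg : ContDiff ℝ (⊤ : ℕ∞) g)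
    (hper : SpacePeriodic g) (j : Fin 3) : ∫ x in Tcube, pd g j x = 0 := by
  have hd := hg.differentiable_of_smooth
  have hsum : ∀ x, (∑ i, (if i = j then fderiv ℝ g x else 0) (Pi.single i 1)) = pd g j x := by
    intro x
    rw [Finset.sum_eq_single j] <;> simp +contextual [pd]
  have hdiv := integral_divergence_of_hasFDerivAt_off_countable' (E := ℝ) (n := 2)
    0 (fun _ => 2 * Real.pi) (fun _ => by positivity)
    (fun i x => if i = j then g x else 0)
    (fun i x => if i = j then fderiv ℝ g x else 0) ∅ Set.countable_empty
    (fun i => by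
      by_cases hi : i = j
      · simpa [hi] using hg.continuous.continuousOn
      · simpa [hi] using continuousOn_const)
    (fun x _ i => by
      by_cases hi : i = j
      · simpa [hi] using (hd x).hasFDerivAt
      · simpa [hi] using hasFDerivAt_const (0 : ℝ) x)
    (by
      simp only [hsum]
      exact (hg.pd j).continuous.integrableOn_Tcube)
  simp only [hsum] at hdiv
  rw [Tcube, hdiv]
  refine Finset.sum_eq_zero fun i _ => ?_
  have hface : ∀ y : Fin 2 → ℝ,
      g (i.insertNth (2 * Real.pi) y) = g (i.insertNth (0 : ℝ) y) := by
    intro y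
    rw [← hper (i.insertNth (0 : ℝ) y) i]
    congr 1
    ext k
    refine Fin.succAboveCases i ?_ (fun k => ?_) k <;> simp
  simp [hface]

/-- For a smooth periodic divergence-free field, `∇v : (∇v)ᵀ` integrates to zero. -/
lemma integral_grad_mul_grad_transpose_eq_zero {v : (Fin 3 → ℝ) → Fin 3 → ℝ}
    (hv : ContDiff ℝ (⊤ : ℕ∞) v) (hper : SpacePeriodic v)
    (hdiv : ∀ x, ∑ i, pd (fun y => v y i) i x = 0) :
    ∫ x in Tcube, ∑ i, ∑ j, pd (fun y => v y j) i x * pd (fun y => v y i) j x = 0 := by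
  have hc : ∀ i, ContDiff ℝ (⊤ : ℕ∞) (fun y => v y i) := contDiff_pi.1 hv
  have hcp : ∀ i, SpacePeriodic (fun y => v y i) := fun i x k => congrFun (hper x k) i
  have hflux : ∀ i j, ContDiff ℝ (⊤ : ℕ∞) (fun y => v y i * pd (fun z => v z j) i y) :=
    fun i j => (hc i).mul ((hc j).pd i)
  have hpt : ∀ x, (∑ i, ∑ j, pd (fun y => v y j) i x * pd (fun y => v y i) j x)
      = ∑ i, ∑ j, pd (fun y => v y i * pd (fun z => v z j) i y) j x := by
    intro x
    refine Finset.sum_congr rfl fun i _ => ?_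
    have hzero : ∑ j, pd (pd (fun z => v z j) i) j x = 0 := by
      simp only [pd_pd_comm (hc _) i]
      rw [← pd_sum (fun j => ((hc j).pd j).differentiable_of_smooth)]
      simp only [hdiv]
      simp [pd]
    simp only [pd_mul (hc i).differentiable_of_smooth ((hc _).pd i).differentiable_of_smooth]
    rw [Finset.sum_add_distrib, ← Finset.mul_sum, hzero, mul_zero, add_zero]
    exact Finset.sum_congr rfl fun j _ => mul_comm _ _
  simp only [hpt]
  have hint : ∀ i j, IntegrableOn (pd (fun y => v y i * pd (fun z => v z j) i y) j) Tcube :=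
    fun i j => ((hflux i j).pd j).continuous.integrableOn_Tcube
  rw [integral_finsetSum _ fun i _ => integrable_finsetSum _ fun j _ => hint i j]
  refine Finset.sum_eq_zero fun i _ => ?_
  rw [integral_finsetSum _ fun j _ => hint i j]
  refine Finset.sum_eq_zero fun j _ => integral_pd_eq_zero (hflux i j) (fun x k => ?_) j
  have h1 := hcp i x k
  have h2 := (hcp j).pd i x k
  simp only at h1 h2 ⊢
  rw [h1, h2]

section TimeDependent

variable {v : ℝ × (Fin 3 → ℝ) → (Fin 3 → ℝ)}

lemma ContDiff.spatial_slice {F : Type*} [NormedAddCommGroup F] [NormedSpace ℝ F]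
    {g : ℝ × (Fin 3 → ℝ) → F} (hg : ContDiff ℝ (⊤ : ℕ∞) g) (t : ℝ) :
    ContDiff ℝ (⊤ : ℕ∞) (fun x => g (t, x)) :=
  hg.comp (contDiff_const.prodMk contDiff_id)

lemma ContDiff.dx (hv : ContDiff ℝ (⊤ : ℕ∞) v) (i j : Fin 3) (t : ℝ) :
    ContDiff ℝ (⊤ : ℕ∞) (dx v i j t) :=
  (contDiff_pi.1 (hv.spatial_slice t) i).pd j

lemma continuous_lap (hv : ContDiff ℝ (⊤ : ℕ∞) v) (i : Fin 3) (t : ℝ) :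
    Continuous (lap v i t) :=
  continuous_finsetSum _ fun j _ => ((hv.dx i j t).pd j).continuous

lemma hasDerivAt_time (hv : ContDiff ℝ (⊤ : ℕ∞) v) (i : Fin 3) (t : ℝ) (x : Fin 3 → ℝ) :
    HasDerivAt (fun s => v (s, x) i) (fderiv ℝ (fun z => v z i) (t, x) (1, 0)) t := by
  have hd : Differentiable ℝ (fun z => v z i) := (contDiff_pi.1 hv i).differentiable_of_smooth
  exact (hd (t, x)).hasFDerivAt.comp_hasDerivAt t ((hasDerivAt_id t).prodMk (hasDerivAt_const t x))

lemma dt_eq_fderiv (hv : ContDiff ℝ (⊤ : ℕ∞) v) (i : Fin 3) (t : ℝ) (x : Fin 3 → ℝ) :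
    dt v i t x = fderiv ℝ (fun z => v z i) (t, x) (1, 0) :=
  (hasDerivAt_time hv i t x).deriv

lemma continuous_dt_s5 (hv : ContDiff ℝ (⊤ : ℕ∞) v) (i : Fin 3) :
    Continuous (fun z : ℝ × (Fin 3 → ℝ) => dt v i z.1 z.2) := by
  simp only [dt_eq_fderiv hv]
  exact ((contDiff_pi.1 hv i).continuous_fderiv (by simp)).clm_apply continuous_const

lemma continuous_dt_slice (hv : ContDiff ℝ (⊤ : ℕ∞) v) (i : Fin 3) (t : ℝ) :
    Continuous (dt v i t) :=
  (continuous_dt_s5 hv i).comp (continuous_const.prodMk continuous_id)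

/-- The kinetic energy of a smooth field may be differentiated under the integral sign. -/
lemma hasDerivAt_energy (hv : ContDiff ℝ (⊤ : ℕ∞) v) (t : ℝ) :
    HasDerivAt (fun s => (1/2) * ∫ x in Tcube, ∑ i, (v (s, x) i)^2)
      (∫ x in Tcube, ∑ i, v (t, x) i * dt v i t x) t := by
  have hvc : ∀ i, Continuous (fun z => v z i) := continuous_pi_iff.1 hv.continuous
  have hcont : Continuous
      (fun z : ℝ × (Fin 3 → ℝ) => ∑ i, 2 * (v z i * dt v i z.1 z.2)) :=
    continuous_finsetSum _ fun i _ => continuous_const.mul ((hvc i).mul (continuous_dt_s5 hv i))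
  have hsq : ∀ s, Continuous (fun x => ∑ i, (v (s, x) i)^2) := fun s =>
    continuous_finsetSum _ fun i _ =>
      ((hvc i).comp (continuous_const.prodMk continuous_id)).pow 2
  obtain ⟨C, hC⟩ := ((isCompact_closedBall t 1).prod
    (isCompact_Icc : IsCompact Tcube)).exists_bound_of_continuousOn hcont.continuousOn
  have hmeas : MeasurableSet Tcube := measurableSet_Icc
  have hder := (hasDerivAt_integral_of_dominated_loc_of_deriv_le
    (μ := volume.restrict Tcube) (𝕜 := ℝ) (x₀ := t) (bound := fun _ => C)
    (F := fun s x => ∑ i, (v (s, x) i)^2)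
    (F' := fun s x => ∑ i, 2 * (v (s, x) i * dt v i s x))
    (Metric.closedBall_mem_nhds t one_pos)
    (Filter.Eventually.of_forall fun s => (hsq s).aestronglyMeasurable)
    (hsq t).integrableOn_Tcube
    (hcont.comp (continuous_const.prodMk continuous_id)).aestronglyMeasurable
    ((ae_restrict_iff' hmeas).2 (Filter.Eventually.of_forall fun x hx s hs => hC (s, x) ⟨hs, hx⟩))
    continuous_const.integrableOn_Tcube
    (Filter.Eventually.of_forall fun x s _ => by
      refine HasDerivAt.fun_sum fun i _ => ?_
      have := (hasDerivAt_time hv i s x).fun_pow 2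
      rw [← dt_eq_fderiv hv] at this
      exact this.congr_deriv (by push_cast; ring))).2
  refine (hder.const_mul (1/2 : ℝ)).congr_deriv ?_
  simp only [← Finset.mul_sum]
  rw [integral_const_mul]
  ring

end TimeDependent

/-- Local energy backscatter of the GLSDD formulation: separate evolution equations
for the large-scale energy `E^h = ½‖u‖²` and the small-scale energy `E′ = ½‖u′‖²`,
with a direct exchange of convective energy between the scales. -/
theorem glsdd_energy_backscatter
    (ν : ℝ) (hν : 0 ≤ ν)
    (u u' f : ℝ × (Fin 3 → ℝ) → (Fin 3 → ℝ))
    (p ζ τ : ℝ × (Fin 3 → ℝ) → ℝ)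
    (hu : ContDiff ℝ (⊤ : ℕ∞) u) (hu' : ContDiff ℝ (⊤ : ℕ∞) u')
    (hf : ContDiff ℝ (⊤ : ℕ∞) f) (hp : ContDiff ℝ (⊤ : ℕ∞) p)
    (hζ : ContDiff ℝ (⊤ : ℕ∞) ζ) (hτ : ContDiff ℝ (⊤ : ℕ∞) τ)
    (hup : ∀ t, SpacePeriodic fun x => u (t, x))
    (hu'p : ∀ t, SpacePeriodic fun x => u' (t, x))
    (hfp : ∀ t, SpacePeriodic fun x => f (t, x))
    (hpp : ∀ t, SpacePeriodic fun x => p (t, x))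
    (hζp : ∀ t, SpacePeriodic fun x => ζ (t, x))
    (hτp : ∀ t, SpacePeriodic fun x => τ (t, x))
    (hτpos : ∀ t x, 0 < τ (t, x))
    -- (i) the large-scale velocity is pointwise divergence free
    (hdiv : ∀ t x, (∑ i, dx u i i t x) = 0)
    -- (ii) orthogonality relations for the small-scales
    (horthζ : ∀ t, (∫ x in Tcube, ∑ i, dxS ζ i t x * u' (t, x) i) = 0)
    (horthp : ∀ t, (∫ x in Tcube, ∑ i, dxS p i t x * u' (t, x) i) = 0)
    (horthΔ : ∀ t, (∫ x in Tcube, ∑ i, lap u i t x * u' (t, x) i) = 0)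
    -- (iii) the dynamic small-scale equation ∂ₜu′ + τ⁻¹u′ + ∇ζ + r = 0
    (hsmall : ∀ t x i,
      dt u' i t x + (τ (t, x))⁻¹ * u' (t, x) i + dxS ζ i t x
        + (dt u i t x + (∑ j, (u (t, x) j + u' (t, x) j) * dx u i j t x)
            + dxS p i t x - ν * lap u i t x - f (t, x) i) = 0)
    -- (iv) the GLSDD large-scale equation tested with (w, q, θ) = (u, p, ζ)
    (hlarge : ∀ t,
      (∫ x in Tcube,
        ((∑ i, u (t, x) i * dt u i t x)
          + (∑ i, u (t, x) i * dt u' i t x)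
          - (∑ i, (∑ j, (u (t, x) j + u' (t, x) j) * dx u i j t x) * u' (t, x) i)
          + 2 * ν * (∑ i, ∑ j, ((1/2) * (dx u i j t x + dx u j i t x)) * dx u i j t x)
          + ν * (∑ i, lap u i t x * u' (t, x) i)
          + (∑ i, dxS ζ i t x * u' (t, x) i)))
      = ∫ x in Tcube, ∑ i, u (t, x) i * f (t, x) i) :
    ∀ t,
      HasDerivAt
        (fun s => (1/2) * ∫ x in Tcube, ∑ i, (u (s, x) i)^2)
        (- (ν * ∫ x in Tcube, ∑ i, ∑ j, (dx u i j t x)^2)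
          + (∫ x in Tcube, ∑ i, u (t, x) i * f (t, x) i)
          + (∫ x in Tcube,
              ∑ i, (∑ j, (u (t, x) j + u' (t, x) j) * dx u i j t x) * u' (t, x) i)
          - (∫ x in Tcube, ∑ i, u (t, x) i * dt u' i t x)) t
      ∧ HasDerivAt
        (fun s => (1/2) * ∫ x in Tcube, ∑ i, (u' (s, x) i)^2)
        (- (∫ x in Tcube, (τ (t, x))⁻¹ * ∑ i, (u' (t, x) i)^2)
          + (∫ x in Tcube, ∑ i, u' (t, x) i * f (t, x) i)
          - (∫ x in Tcube,
              ∑ i, (∑ j, (u (t, x) j + u' (t, x) j) * dx u i j t x) * u' (t, x) i)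
          - (∫ x in Tcube, ∑ i, u' (t, x) i * dt u i t x)) t := by
  intro t
  have hc : ∀ {w : ℝ × (Fin 3 → ℝ) → (Fin 3 → ℝ)}, ContDiff ℝ (⊤ : ℕ∞) w →
      ∀ i, Continuous (fun x => w (t, x) i) := fun hw =>
    continuous_pi_iff.1 (hw.spatial_slice t).continuous
  have hdx : ∀ i j, Continuous (dx u i j t) := fun i j => (hu.dx i j t).continuous
  have hdxS : ∀ {q : ℝ × (Fin 3 → ℝ) → ℝ}, ContDiff ℝ (⊤ : ℕ∞) q →
      ∀ i, Continuous (dxS q i t) := fun hq i => ((hq.spatial_slice t).pd i).continuous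
  have hlap := fun i => continuous_lap hu i t
  have hdtu := fun i => continuous_dt_slice hu i t
  have hdtu' := fun i => continuous_dt_slice hu' i t
  have hcu := hc hu
  have hcu' := hc hu'
  have hcf := hc hf
  have hcζ := hdxS hζ
  have hcp := hdxS hp
  have hcτ : Continuous (fun x => (τ (t, x))⁻¹) :=
    (hτ.spatial_slice t).continuous.inv₀ fun x => (hτpos t x).ne'
  have hconv : ∀ i, Continuous (fun x => ∑ j, (u (t, x) j + u' (t, x) j) * dx u i j t x) :=
    fun i => continuous_finsetSum _ fun j _ => ((hcu j).add (hcu' j)).mul (hdx i j)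
  have iE := integrableOn_Tcube_sum_mul hcu hdtu
  have iX := integrableOn_Tcube_sum_mul hcu hdtu'
  have iX' := integrableOn_Tcube_sum_mul hcu' hdtu
  have iC := integrableOn_Tcube_sum_mul hconv hcu'
  have iL := integrableOn_Tcube_sum_mul hlap hcu'
  have iζ := integrableOn_Tcube_sum_mul hcζ hcu'
  have ip := integrableOn_Tcube_sum_mul hcp hcu'
  have iF' := integrableOn_Tcube_sum_mul hcu' hcf
  have iG : IntegrableOn (fun x => ∑ i, ∑ j, (dx u i j t x)^2) Tcube :=
    (continuous_finsetSum _ fun i _ =>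
      continuous_finsetSum _ fun j _ => (hdx i j).pow 2).integrableOn_Tcube
  have iGT : IntegrableOn (fun x => ∑ i, ∑ j, dx u j i t x * dx u i j t x) Tcube :=
    (continuous_finsetSum _ fun i _ =>
      continuous_finsetSum _ fun j _ => (hdx j i).mul (hdx i j)).integrableOn_Tcube
  have iτ : IntegrableOn (fun x => (τ (t, x))⁻¹ * ∑ i, (u' (t, x) i)^2) Tcube :=
    (hcτ.mul (continuous_finsetSum _ fun i _ => (hcu' i).pow 2)).integrableOn_Tcube
  have hGT : ∫ x in Tcube, ∑ i, ∑ j, dx u j i t x * dx u i j t x = 0 :=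
    integral_grad_mul_grad_transpose_eq_zero (hu.spatial_slice t) (hup t) (hdiv t)
  refine ⟨(hasDerivAt_energy hu t).congr_deriv ?_, (hasDerivAt_energy hu' t).congr_deriv ?_⟩
  · have hsym : ∀ x, 2 * ν * (∑ i, ∑ j, ((1/2) * (dx u i j t x + dx u j i t x)) * dx u i j t x)
        = ν * (∑ i, ∑ j, (dx u i j t x)^2) + ν * ∑ i, ∑ j, dx u j i t x * dx u i j t x := by
      intro x
      simp only [Fin.sum_univ_three]
      ring
    have h := hlarge t
    simp only [hsym] at h
    rw [integral_add, integral_add,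
      integral_add, integral_sub,
      integral_add, integral_add,
      integral_const_mul, integral_const_mul, integral_const_mul, hGT, horthΔ t, horthζ t] at h
    · linarith
    all_goals
      repeat' first
        | assumption
        | apply Integrable.fun_add
        | apply Integrable.sub'
        | apply Integrable.fun_neg
        | apply Integrable.const_mul
  · have hpt : ∀ x, ∑ i, u' (t, x) i * dt u' i t x
        = -((τ (t, x))⁻¹ * ∑ i, (u' (t, x) i)^2) + (∑ i, u' (t, x) i * f (t, x) i)
          - (∑ i, (∑ j, (u (t, x) j + u' (t, x) j) * dx u i j t x) * u' (t, x) i)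
          - (∑ i, u' (t, x) i * dt u i t x) - (∑ i, dxS ζ i t x * u' (t, x) i)
          - (∑ i, dxS p i t x * u' (t, x) i) + ν * (∑ i, lap u i t x * u' (t, x) i) := by
      intro x
      rw [← sub_eq_zero]
      simp only [Finset.mul_sum, ← Finset.sum_neg_distrib, ← Finset.sum_add_distrib,
        ← Finset.sum_sub_distrib]
      refine Finset.sum_eq_zero fun i _ => ?_
      linear_combination u' (t, x) i * hsmall t x i
    simp only [hpt]
    rw [integral_add, integral_sub,
      integral_sub, integral_sub,
      integral_sub, integral_add,
      integral_neg, integral_const_mul, horthΔ t, horthζ t, horthp t]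
    · ring
    all_goals
      repeat' first
        | assumption
        | apply Integrable.fun_add
        | apply Integrable.sub'
        | apply Integrable.fun_neg
        | apply Integrable.const_mul
end
end

section
/- Let u, u′ : ℝ×ℝ³ → ℝ³ and f : ℝ×ℝ³ → ℝ³ be smooth and periodic in space, and let c ∈ ℝ³ be a fixed constant vector. Assume that for every time t: (i) div u(t,·) = 0 pointwise; (ii) the GLSDD formulation tested with weighting functions (w,q,θ) = (c, 0, −½ c·u) holds, i.e. ∫_T [ c·∂ₜ(u+u′) + ½ c·(((u+u′)·∇)u) − ½ ∇(c·u)·u′ ] dx = ∫_T c·f dx. Then for every t, d/dt ∫_T c·(u+u′) dx = ∫_T c·f dx, i.e. linear momentum of the total solution is conserved. -/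
open MeasureTheory Real

noncomputable section

/-- The integral over the periodicity cube of the divergence of a `C¹` periodic vector field
vanishes. -/
theorem integral_sum_pd_eq_zero {F : Fin 3 → (Fin 3 → ℝ) → ℝ}
    (hF : ∀ i, ContDiff ℝ 1 (F i)) (hp : ∀ i, SpacePeriodic (F i)) :
    ∫ x in Tcube, ∑ i, pd (F i) i x = 0 := by
  have hc : Continuous fun x => ∑ i, pd (F i) i x :=
    continuous_finsetSum _ fun i _ =>
      ((hF i).continuous_fderiv one_ne_zero).clm_apply continuous_const
  have h := integral_divergence_of_hasFDerivAt_off_countable'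
    (a := (0 : Fin 3 → ℝ)) (b := fun _ => 2 * Real.pi)
    (fun _ => by simp [Real.pi_pos.le]) F (fun i x => fderiv ℝ (F i) x) ∅ Set.countable_empty
    (fun i => (hF i).continuous.continuousOn)
    (fun x _ i => ((hF i).differentiable one_ne_zero x).hasFDerivAt)
    (hc.continuousOn.integrableOn_compact isCompact_Icc)
  refine h.trans (Finset.sum_eq_zero fun i _ => sub_eq_zero.2 ?_)
  refine integral_congr_ae (Filter.Eventually.of_forall fun y => ?_)
  have hface : i.insertNth (2 * Real.pi) y
      = (i.insertNth (0 : ℝ) y : Fin 3 → ℝ) + Pi.single i (2 * Real.pi) := by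
    ext j
    induction j using i.succAboveCases <;> simp
  simpa [hface] using hp i (i.insertNth (0 : ℝ) y) i

/-- Differentiation under the integral sign over a compact set, for a `C¹` integrand. -/
theorem hasDerivAt_setIntegral_of_contDiff {E : Type*} [NormedAddCommGroup E] [NormedSpace ℝ E]
    [MeasurableSpace E] [BorelSpace E] {μ : Measure E} [IsFiniteMeasureOnCompacts μ]
    {g : ℝ × E → ℝ} (hg : ContDiff ℝ 1 g) {K : Set E} (hK : IsCompact K) (t : ℝ) :
    HasDerivAt (fun s => ∫ x in K, g (s, x) ∂μ)
      (∫ x in K, deriv (fun s => g (s, x)) t ∂μ) t := by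
  have hd : ∀ s x, HasDerivAt (fun s => g (s, x)) (fderiv ℝ g (s, x) (1, 0)) s := fun s x =>
    (hg.differentiable one_ne_zero (s, x)).hasFDerivAt.comp_hasDerivAt s
      ((hasDerivAt_id s).prodMk (hasDerivAt_const s x))
  have hc : Continuous fun p : ℝ × E => fderiv ℝ g p (1, 0) :=
    (hg.continuous_fderiv one_ne_zero).clm_apply continuous_const
  have hmeas : ∀ h : E → ℝ, Continuous h → IntegrableOn h K μ := fun h hh =>
    hh.continuousOn.integrableOn_compact hK
  obtain ⟨C, hC⟩ := ((isCompact_closedBall t 1).prod hK).exists_bound_of_continuousOn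
    hc.continuousOn
  simp only [(hd _ _).deriv]
  refine (hasDerivAt_integral_of_dominated_loc_of_deriv_le (bound := fun _ => C)
    (F' := fun s x => fderiv ℝ g (s, x) (1, 0))
    (Metric.closedBall_mem_nhds t one_pos)
    (Filter.Eventually.of_forall fun s =>
      (hmeas _ (hg.continuous.comp (by fun_prop))).aestronglyMeasurable)
    (hmeas _ (hg.continuous.comp (by fun_prop)))
    (hmeas _ (hc.comp (by fun_prop))).aestronglyMeasurable ?_
    (hmeas _ continuous_const)
    (Filter.Eventually.of_forall fun x s _ => hd s x)).2
  exact ae_restrict_of_forall_mem hK.measurableSet fun x hx s hs => hC (s, x) ⟨hs, hx⟩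

/-- Conservation of linear momentum of the total solution `u + u′` for the GLSDD
formulation, tested with the weighting functions `(w, q, θ) = (c, 0, -½ c·u)`. -/
theorem glsdd_linear_momentum_conservation
    (u u' f : ℝ × (Fin 3 → ℝ) → (Fin 3 → ℝ))
    (c : Fin 3 → ℝ)
    (hu : ContDiff ℝ (⊤ : ℕ∞) u) (hu' : ContDiff ℝ (⊤ : ℕ∞) u')
    (hf : ContDiff ℝ (⊤ : ℕ∞) f)
    (hup : ∀ t, SpacePeriodic fun x => u (t, x))
    (hu'p : ∀ t, SpacePeriodic fun x => u' (t, x))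
    (hfp : ∀ t, SpacePeriodic fun x => f (t, x))
    -- (i) the large-scale velocity is pointwise divergence free
    (hdiv : ∀ t x, (∑ i, dx u i i t x) = 0)
    -- (ii) the GLSDD formulation tested with (w, q, θ) = (c, 0, -½ c·u)
    (htested : ∀ t,
      (∫ x in Tcube,
        ((∑ i, c i * (dt u i t x + dt u' i t x))
          + (1/2) * (∑ i, c i * (∑ j, (u (t, x) j + u' (t, x) j) * dx u i j t x))
          - (1/2) * (∑ j, pd (fun y => ∑ i, c i * u (t, y) i) j x * u' (t, x) j)))
      = ∫ x in Tcube, ∑ i, c i * f (t, x) i) :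
    ∀ t, HasDerivAt
      (fun s => ∫ x in Tcube, ∑ i, c i * (u (s, x) i + u' (s, x) i))
      (∫ x in Tcube, ∑ i, c i * f (t, x) i) t := by
  intro t
  have hu1 : ContDiff ℝ 1 u := hu.of_le (by exact_mod_cast le_top)
  have hu'1 : ContDiff ℝ 1 u' := hu'.of_le (by exact_mod_cast le_top)
  have hui : ∀ i, ContDiff ℝ 1 fun p => u p i := contDiff_pi.1 hu1
  have hu'i : ∀ i, ContDiff ℝ 1 fun p => u' p i := contDiff_pi.1 hu'1
  have hv : ∀ i, ContDiff ℝ 1 fun x => u (t, x) i := fun i =>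
    (hui i).comp (contDiff_const.prodMk contDiff_id)
  have hG : ContDiff ℝ 1 fun p => ∑ i, c i * (u p i + u' p i) :=
    ContDiff.sum fun i _ => contDiff_const.mul ((hui i).add (hu'i i))
  have hderiv : ∀ x, deriv (fun s => ∑ i, c i * (u (s, x) i + u' (s, x) i)) t
      = ∑ i, c i * (dt u i t x + dt u' i t x) := fun x => by
    have hd : ∀ w : ℝ × (Fin 3 → ℝ) → (Fin 3 → ℝ), (∀ i, ContDiff ℝ 1 fun p => w p i) →
        ∀ i, HasDerivAt (fun s => w (s, x) i) (dt w i t x) t := fun w hw i =>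
      (((hw i).comp (contDiff_id.prodMk contDiff_const)).differentiable
        one_ne_zero t).hasDerivAt
    exact (HasDerivAt.fun_sum fun i _ =>
      ((hd u hui i).add (hd u' hu'i i)).const_mul (c i)).deriv
  have hK : IsCompact Tcube := isCompact_Icc
  have hA : Continuous fun x => ∑ i, c i * (dt u i t x + dt u' i t x) := by
    have hdt : ∀ w : ℝ × (Fin 3 → ℝ) → (Fin 3 → ℝ), (∀ i, ContDiff ℝ 1 fun p => w p i) →
        ∀ i, Continuous fun x => dt w i t x := fun w hw i => by
      have : (fun x => dt w i t x) = fun x => fderiv ℝ (fun p => w p i) (t, x) (1, 0) := by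
        ext x
        exact (((hw i).differentiable one_ne_zero (t, x)).hasFDerivAt.comp_hasDerivAt t
          ((hasDerivAt_id t).prodMk (hasDerivAt_const t x))).deriv
      rw [this]
      exact (((hw i).continuous_fderiv one_ne_zero).comp (by fun_prop)).clm_apply
        continuous_const
    exact continuous_finsetSum _ fun i _ =>
      continuous_const.mul ((hdt u hui i).add (hdt u' hu'i i))
  have hcu : ContDiff ℝ 1 fun y => ∑ i, c i * u (t, y) i :=
    ContDiff.sum fun i _ => contDiff_const.mul (hv i)
  have hflux : ∀ j, ContDiff ℝ 1 fun y => u (t, y) j * ∑ i, c i * u (t, y) i := fun j =>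
    (hv j).mul hcu
  have hfluxp : ∀ j, SpacePeriodic fun y => u (t, y) j * ∑ i, c i * u (t, y) i :=
    fun j x k => by simp only [show u (t, x + Pi.single k (2 * Real.pi)) = u (t, x) from hup t x k]
  have hpdcu : ∀ j x, pd (fun y => ∑ i, c i * u (t, y) i) j x = ∑ i, c i * dx u i j t x :=
    fun j x => by
      have := HasFDerivAt.fun_sum (u := Finset.univ) fun i _ =>
        ((hv i).differentiable one_ne_zero x).hasFDerivAt.const_mul (c i)
      simp [pd, dx, this.fderiv]
  have hpdflux : ∀ x, ∑ j, pd (fun y => u (t, y) j * ∑ i, c i * u (t, y) i) j x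
      = ∑ j, u (t, x) j * ∑ i, c i * dx u i j t x := fun x => by
    have hj : ∀ j, pd (fun y => u (t, y) j * ∑ i, c i * u (t, y) i) j x
        = u (t, x) j * (∑ i, c i * dx u i j t x)
          + (∑ i, c i * u (t, x) i) * dx u j j t x := fun j => by
      rw [← hpdcu]
      simp [pd, dx, fderiv_fun_mul ((hv j).differentiable one_ne_zero x)
        (hcu.differentiable one_ne_zero x)]
    simp_rw [hj, Finset.sum_add_distrib, ← Finset.mul_sum, hdiv, mul_zero, add_zero]
  have hB : Continuous fun x =>
      ∑ j, pd (fun y => u (t, y) j * ∑ i, c i * u (t, y) i) j x :=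
    continuous_finsetSum _ fun j _ =>
      ((hflux j).continuous_fderiv one_ne_zero).clm_apply continuous_const
  have hsplit : ∀ x, (∑ i, c i * (dt u i t x + dt u' i t x))
      + (1/2) * (∑ i, c i * (∑ j, (u (t, x) j + u' (t, x) j) * dx u i j t x))
      - (1/2) * (∑ j, pd (fun y => ∑ i, c i * u (t, y) i) j x * u' (t, x) j)
      = (∑ i, c i * (dt u i t x + dt u' i t x))
        + (1/2) * ∑ j, pd (fun y => u (t, y) j * ∑ i, c i * u (t, y) i) j x := fun x => by
    simp only [hpdflux, hpdcu]
    simp only [Fin.sum_univ_three]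
    ring
  have hval : ∫ x in Tcube, ∑ i, c i * f (t, x) i
      = ∫ x in Tcube, ∑ i, c i * (dt u i t x + dt u' i t x) := by
    rw [← htested t]
    simp only [hsplit]
    rw [integral_add (hA.continuousOn.integrableOn_compact hK)
      ((hB.continuousOn.integrableOn_compact hK).const_mul _), integral_const_mul,
      integral_sum_pd_eq_zero hflux hfluxp, mul_zero, add_zero]
  rw [hval]
  simpa only [hderiv] using hasDerivAt_setIntegral_of_contDiff (μ := volume) hG hK t
end
end
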